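/- In the free group F_k (k ≥ 1) with standard generating set, if W is a reduced word of the form ξ^{ε_1} x_1 ξ^{ε_2} x_2 ⋯ ξ^{ε_k} x_k where ξ satisfies the small cancellation condition C'(1/5), has |ξ| ≥ 10000, is 3-aperiodic, and the words x_i are reduced of length at most 192 forming a 10-aperiodic sequence of nontrivial words, then the reduced form of W is 500-aperiodic. In particular |W|, as an element of F_k, is at least |ξ| − 800 > 192. -/

import Mathlib

/-- A list is `k`-aperiodic if it contains no factor of the form `y^(k+1)` with `y` nonempty. -/
def KAperiodic {α : Type*} (k : ℕ) (l : List α) : Prop :=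
  ∀ x y z : List α, l = x ++ (List.replicate (k + 1) y).flatten ++ z → y = []

/-- The formal inverse of a word over the alphabet `α × Bool`. -/
def wordInv {α : Type*} (w : List (α × Bool)) : List (α × Bool) :=
  (w.map fun p => (p.1, !p.2)).reverse

/-- The symmetrization of a set of words: all cyclic shifts of the words and of
their inverses. -/
def SymSet {α : Type*} (R : Set (List (α × Bool))) : Set (List (α × Bool)) :=
  {u | ∃ w ∈ R, ∃ i : ℕ, u = w.rotate i ∨ u = (wordInv w).rotate i}

/-- The small cancellation condition `C'(μ)`: every piece (common prefix of two
distinct elements of the symmetrization) of a word `u` in the symmetrization has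
length `< μ|u|`. -/
def CPrime {α : Type*} (μ : ℚ) (R : Set (List (α × Bool))) : Prop :=
  ∀ u ∈ SymSet R, ∀ v ∈ SymSet R, u ≠ v →
    ∀ P : List (α × Bool), P <+: u → P <+: v → (P.length : ℚ) < μ * u.length

/-- The product `ξ^{ε₁} x₁ ξ^{ε₂} x₂ ⋯ ξ^{ε_k} x_k`, where the list `l` records the
pairs `(xᵢ, εᵢ)` (with `true` standing for `+1` and `false` for `-1`). -/
def sprod {G : Type*} [Group G] (ξ : G) (l : List (G × Bool)) : G :=
  (l.map fun p => (if p.2 then ξ else ξ⁻¹) * p.1).prod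

namespace Lem5

open FreeGroup

set_option linter.unusedSectionVars false

/-- A contiguous subword of a reduced word is reduced. -/
theorem red_sub {α : Type*} {u w : List (α × Bool)} (hw : IsReduced w) (h : u <:+: w) :
    IsReduced u := by
  obtain ⟨s, t, rfl⟩ := h
  exact List.IsChain.right_of_append (List.IsChain.left_of_append hw)


theorem KAp_three {α : Type*} {v : List α} (h : KAperiodic 3 v) {x y z : List α}
    (e : v = x ++ (y ++ (y ++ (y ++ (y ++ z))))) : y = [] := by
  apply h x y z
  rw [e]
  simp [List.replicate_succ]

/-- Four equal consecutive blocks contradict 3-aperiodicity. -/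
theorem no_block {α : Type*} {v : List α} (h : KAperiodic 3 v) (s d : ℕ) (hd : 0 < d)
    (hl : s + 4 * d ≤ v.length)
    (key : ∀ t, s ≤ t → t + d ≤ s + 3 * d →
      (v.drop (t + d)).take d = (v.drop t).take d) : False := by
  have split : ∀ t, v.drop t = (v.drop t).take d ++ v.drop (t + d) := by
    intro t
    conv_lhs => rw [← List.take_append_drop d (v.drop t)]
    rw [List.drop_drop]
  have e1 := key s (by omega) (by omega)
  have e2 := key (s + d) (by omega) (by omega)
  have e3 := key (s + d + d) (by omega) (by omega)
  have : (v.drop s).take d = [] := by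
    apply KAp_three h (x := v.take s) (z := v.drop (s + d + d + d + d))
    conv_lhs => rw [← List.take_append_drop s v, split s, split (s + d), split (s + d + d),
      split (s + d + d + d), e3, e2, e1]
  have h2 := congrArg List.length this
  simp at h2
  omega

/-- A long enough periodic stretch contradicts 3-aperiodicity. -/
theorem no_period {α : Type*} {v : List α} (h : KAperiodic 3 v) (s d : ℕ) (hd : 0 < d)
    (hl : s + 4 * d ≤ v.length)
    (hp : ∀ i, s ≤ i → i < s + 3 * d → v[i]? = v[i + d]?) : False := by
  apply no_block h s d hd hl
  intro t ht1 ht2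
  apply List.ext_getElem?
  intro i
  by_cases hi : i < d
  · rw [List.getElem?_take_of_lt hi, List.getElem?_take_of_lt hi, List.getElem?_drop,
      List.getElem?_drop, hp (t + i) (by omega) (by omega)]
    congr 1
    omega
  · rw [List.getElem?_take_eq_none (by omega), List.getElem?_take_eq_none (by omega)]

/-- A periodic list is a power. -/
theorem periodic_pow {α : Type*} (q : ℕ) (r : ℕ) : ∀ y : List α, (r + 1) * q ≤ y.length →
    (∀ k, k < r * q → y[k]? = y[k + q]?) →
    y.take ((r + 1) * q) = (List.replicate (r + 1) (y.take q)).flatten := by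
  induction r with
  | zero => intro y _ _; simp
  | succ r ih =>
    intro y hl hp
    have e1 : (r + 1 + 1) * q = q + (r + 1) * q := by ring
    have e2 : (r + 1) * q = q + r * q := by ring
    rw [e1, List.take_add, ih (y.drop q) (by simp; omega), List.replicate_succ (n := r + 1),
      List.flatten_cons]
    · congr 3
      apply List.ext_getElem?
      intro i
      by_cases hi : i < q
      · rw [List.getElem?_take_of_lt hi, List.getElem?_take_of_lt hi, List.getElem?_drop,
          hp i (by omega), add_comm]
      · rw [List.getElem?_take_eq_none (by omega), List.getElem?_take_eq_none (by omega)]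
    · intro k hk
      rw [List.getElem?_drop, List.getElem?_drop, add_comm q k, hp (k + q) (by omega)]
      congr 1; omega

theorem KAp_inv {α : Type*} {v : List (α × Bool)} (h : KAperiodic 3 v) :
    KAperiodic 3 (invRev v) := by
  intro x y z e
  have : invRev y = [] := by
    apply KAp_three h (x := invRev z) (z := invRev x)
    rw [← invRev_invRev (L₁ := v), e]
    simp [List.replicate_succ, invRev_append]
  simpa using congrArg List.length this

theorem rot_period {α : Type*} {v : List α} {d : ℕ} (hd : v.rotate d = v) (hdn : d ≤ v.length)
    (i : ℕ) (hi : i + d < v.length) : v[i]? = v[i + d]? := by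
  conv_lhs => rw [← hd, List.rotate_eq_drop_append_take hdn]
  rw [List.getElem?_append_left (by simp; omega), List.getElem?_drop]
  congr 1
  omega

/-- root lemma -/
theorem root_large {α : Type*} {v : List α} (h : KAperiodic 3 v) {d : ℕ} (hd : v.rotate d = v)
    (h0 : 0 < d) (hdn : d < v.length) : v.length ≤ 3 * d := by
  by_contra hc
  push Not at hc
  by_cases h4 : 4 * d ≤ v.length
  · exact no_period h 0 d h0 (by omega) fun i _ hi => rot_period hd hdn.le i (by omega)
  · have he : v.rotate (v.length - 3 * d) = v := by
      have h3 : v.rotate (3 * d) = v := by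
        have : 3 * d = d + d + d := by ring
        rw [this, ← List.rotate_rotate, ← List.rotate_rotate, hd, hd, hd]
      have h5 : (v.rotate (3 * d)).rotate (v.length - 3 * d) = v.rotate (v.length - 3 * d) := by
        rw [h3]
      rw [← h5, List.rotate_rotate, show 3 * d + (v.length - 3 * d) = v.length by omega,
        List.rotate_length]
    exact no_period h 0 (v.length - 3 * d) (by omega) (by omega)
      fun i _ hi => rot_period he (by omega) i (by omega)

theorem rot_sub {α : Type*} {v : List α} {i j : ℕ} (hij : i ≤ j)
    (h : v.rotate i = v.rotate j) : v.rotate (j - i) = v := by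
  have : (v.rotate (j - i)).rotate i = v.rotate i := by
    rw [List.rotate_rotate, h]; congr 1; omega
  exact List.rotate_injective i this

section
variable {α : Type*} [DecidableEq α]

theorem eq_of_mk {u v : List (α × Bool)} (hu : IsReduced u) (hv : IsReduced v)
    (h : mk u = mk v) : u = v := by
  rw [← hu.reduce_eq, ← hv.reduce_eq]; exact reduce.sound h

theorem toWord_of_reduced {u : List (α × Bool)} (hu : IsReduced u) : (mk u).toWord = u := by
  rw [toWord_mk, hu.reduce_eq]

theorem red_take {u : List (α × Bool)} (hu : IsReduced u) (t : ℕ) : IsReduced (u.take t) :=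
  red_sub hu (List.take_prefix t u).isInfix

theorem red_drop {u : List (α × Bool)} (hu : IsReduced u) (t : ℕ) : IsReduced (u.drop t) :=
  red_sub hu (List.drop_suffix t u).isInfix

theorem inv_self {z : List (α × Bool)} (hz : IsReduced z) (h : z = invRev z) : z = [] := by
  have h1 : (mk z) ^ 2 = 1 := by
    rw [pow_two]
    nth_rewrite 2 [h]
    rw [← inv_mk, mul_inv_cancel]
  have h2 : mk z = 1 := (pow_eq_one_iff_left (by norm_num)).1 h1
  rw [← toWord_of_reduced hz, h2, toWord_one]

/-- no cyclic shift of a reduced word is a cyclic shift of its inverse -/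
theorem rot_inv_ne {v : List (α × Bool)} (hv : IsReduced v) (hne : v ≠ []) (i j : ℕ) :
    v.rotate i ≠ (invRev v).rotate j := by
  intro h
  obtain ⟨m, hm⟩ : ∃ m, v.rotate m = invRev v := by
    have := List.rotate_eq_iff.1 h.symm
    rw [List.rotate_rotate] at this
    exact ⟨_, this.symm⟩
  rw [← List.rotate_mod] at hm
  have hlt : m % v.length ≤ v.length := (Nat.mod_lt _ (List.length_pos_iff.2 hne)).le
  generalize m % v.length = q at hm hlt
  rw [List.rotate_eq_drop_append_take hlt] at hm
  conv_rhs at hm => rw [← List.take_append_drop q v, invRev_append]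
  obtain ⟨h1, h2⟩ := List.append_inj hm (by simp [invRev_length])
  have e1 := inv_self (red_drop hv q) h1
  have e2 := inv_self (red_take hv q) h2
  apply hne
  rw [← List.take_append_drop q v, e1, e2]; rfl

/-- Cancellation lemma. -/
theorem cancel (x : List (α × Bool)) : ∀ u : List (α × Bool), IsReduced u → IsReduced x →
    ∃ u1 s x1, u = u1 ++ s ∧ x = invRev s ++ x1 ∧ IsReduced (u1 ++ x1) := by
  induction x with
  | nil => intro u hu _; exact ⟨u, [], [], by simp, by simp, by simpa using hu⟩
  | cons a x ih =>
    intro u hu hx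
    rcases List.eq_nil_or_concat u with rfl | ⟨u', e, rfl⟩
    · exact ⟨[], [], a :: x, by simp, by simp, by simpa using hx⟩
    · rw [List.concat_eq_append] at *
      by_cases hea : a = (e.1, !e.2)
      · obtain ⟨u1, s, x1, h1, h2, h3⟩ := ih u' (red_sub hu (List.prefix_append _ _).isInfix)
          (red_sub hx (List.suffix_cons _ _).isInfix)
        refine ⟨u1, s ++ [e], x1, by rw [h1]; simp, ?_, h3⟩
        rw [invRev_append, h2, hea]
        simp [invRev]
      · refine ⟨u' ++ [e], [], a :: x, by simp, by simp, ?_⟩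
        have h2 : IsReduced ([e] ++ a :: x) := by
          unfold FreeGroup.IsReduced at *
          rw [List.singleton_append, List.isChain_cons_cons]
          refine ⟨fun h => ?_, hx⟩
          by_contra hne
          apply hea
          ext
          · exact h.symm
          · simp only
            revert hne
            cases e.2 <;> cases a.2 <;> simp
        exact hu.append_overlap h2 (by simp)

end


section
variable {α : Type*} [DecidableEq α]

/-- `ξ` or its inverse -/
def sg (ξ : FreeGroup α) (ε : Bool) : FreeGroup α := if ε then ξ else ξ⁻¹

/-- the hypotheses on `ξ` that are used -/
structure Hyp (ξ : FreeGroup α) : Prop where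
  hap : KAperiodic 3 ξ.toWord
  hlen : 10000 ≤ ξ.toWord.length
  hsc : CPrime (1/5) {ξ.toWord}

theorem sg_not (ξ : FreeGroup α) (ε : Bool) : sg ξ (!ε) = (sg ξ ε)⁻¹ := by
  cases ε <;> simp [sg]

theorem X_not (ξ : FreeGroup α) (ε : Bool) :
    (sg ξ (!ε)).toWord = invRev (sg ξ ε).toWord := by
  rw [sg_not, toWord_inv]

theorem X_len (ξ : FreeGroup α) (ε : Bool) : (sg ξ ε).toWord.length = ξ.toWord.length := by
  cases ε <;> simp [sg, toWord_inv]

theorem X_ap {ξ : FreeGroup α} (H : Hyp ξ) (ε : Bool) : KAperiodic 3 (sg ξ ε).toWord := by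
  cases ε
  · rw [show sg ξ false = ξ⁻¹ by simp [sg], toWord_inv]; exact KAp_inv H.hap
  · exact H.hap

theorem X_sym (ξ : FreeGroup α) (ε : Bool) (i : ℕ) :
    (sg ξ ε).toWord.rotate i ∈ SymSet {ξ.toWord} := by
  refine ⟨ξ.toWord, rfl, i, ?_⟩
  cases ε
  · right; rw [show sg ξ false = ξ⁻¹ by simp [sg], toWord_inv]; rfl
  · left; rfl

theorem piece {ξ : FreeGroup α} (H : Hyp ξ) {ε δ : Bool} {i j : ℕ} {P : List (α × Bool)}
    (h1 : P <+: (sg ξ ε).toWord.rotate i) (h2 : P <+: (sg ξ δ).toWord.rotate j)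
    (hP : ξ.toWord.length ≤ 5 * P.length) :
    δ = ε ∧ (sg ξ ε).toWord.rotate i = (sg ξ ε).toWord.rotate j := by
  have heq : (sg ξ ε).toWord.rotate i = (sg ξ δ).toWord.rotate j := by
    by_contra hne
    have := H.hsc _ (X_sym ξ ε i) _ (X_sym ξ δ j) hne P h1 h2
    rw [List.length_rotate, X_len] at this
    have hP' : (ξ.toWord.length : ℚ) ≤ 5 * P.length := by exact_mod_cast hP
    linarith
  by_cases hd : δ = ε
  · subst hd; exact ⟨rfl, heq⟩
  · have : δ = !ε := by revert hd; cases δ <;> cases ε <;> simp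
    rw [this, X_not] at heq
    refine absurd heq (rot_inv_ne isReduced_toWord ?_ i j)
    intro h0
    have := X_len ξ ε
    have h3 := H.hlen
    rw [h0] at this
    simp at this
    omega

/-- Junction lemma: how `ξ^ε x ξ^δ` reduces. -/
theorem junction {ξ : FreeGroup α} (H : Hyp ξ) (ε δ : Bool) (x : FreeGroup α) (hx : x ≠ 1)
    (hxl : x.toWord.length ≤ 192) :
    ∃ (a b : ℕ) (r : List (α × Bool)), a ≤ ξ.toWord.length / 5 + 192 ∧
      b ≤ ξ.toWord.length / 5 + 192 ∧ r.length ≤ 192 ∧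
      IsReduced ((sg ξ ε).toWord.take (ξ.toWord.length - a) ++ r ++ (sg ξ δ).toWord.drop b) ∧
      mk ((sg ξ ε).toWord.take (ξ.toWord.length - a) ++ r) =
        sg ξ ε * x * mk ((sg ξ δ).toWord.take b) := by
  have hn := H.hlen
  have hlu := X_len ξ ε
  have hlT := X_len ξ δ
  have hXnot := X_not ξ ε
  have hmku : mk (sg ξ ε).toWord = sg ξ ε := mk_toWord
  have hmkx : mk x.toWord = x := mk_toWord
  have hru : IsReduced (sg ξ ε).toWord := isReduced_toWord
  have hrT : IsReduced (sg ξ δ).toWord := isReduced_toWord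
  have hrx : IsReduced x.toWord := isReduced_toWord
  have hpiece := @piece α _ ξ H (!ε) δ
  have hap := X_ap H (!ε)
  rw [hXnot] at hpiece hap
  generalize (sg ξ ε).toWord = u at *
  generalize hT' : (sg ξ δ).toWord = T at *
  obtain ⟨u1, s, x1, e1, e2, hr1⟩ := cancel x.toWord u hru hrx
  have hrx1 : IsReduced x1 := red_sub hr1 (List.suffix_append _ _).isInfix
  obtain ⟨x2, s2, T2, e3, e4, hr2⟩ := cancel T x1 hrx1 hrT
  have l1 := congrArg List.length e1
  have l2 := congrArg List.length e2
  have l3 := congrArg List.length e3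
  have l4 := congrArg List.length e4
  simp only [List.length_append, invRev_length] at l1 l2 l3 l4
  have gx : x = (mk s)⁻¹ * (mk x2 * mk s2) := by
    rw [← hmkx, e2, e3, ← mul_mk, ← mul_mk, ← inv_mk]
  have gu : sg ξ ε = mk u1 * mk s := by rw [← hmku, e1, ← mul_mk]
  by_cases hx2 : x2 = []
  · subst hx2
    have hrT2 : IsReduced T2 := by simpa using hr2
    have hru1 : IsReduced u1 := red_sub hr1 (List.prefix_append _ _).isInfix
    obtain ⟨u3, s3, T3, e5, e6, hr3⟩ := cancel T2 u1 hru1 hrT2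
    have l5 := congrArg List.length e5
    have l6 := congrArg List.length e6
    simp only [List.length_append, invRev_length, List.length_nil] at l3 l5 l6
    have hs3 : 5 * s3.length < ξ.toWord.length := by
      by_contra hc
      push Not at hc
      have r1 : (invRev u).rotate s.length = invRev s3 ++ (invRev u3 ++ invRev s) := by
        have : invRev u = invRev s ++ (invRev s3 ++ invRev u3) := by
          rw [e1, e5]; simp [invRev_append]
        rw [this, ← invRev_length (L₁ := s), List.rotate_append_length_eq]; simp
      have r2 : T.rotate s2.length = invRev s3 ++ (T3 ++ invRev s2) := by
        rw [e4, e6, ← invRev_length (L₁ := s2), List.rotate_append_length_eq]; simp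
      obtain ⟨hd, hrot⟩ := hpiece (P := invRev s3) (i := s.length) (j := s2.length)
        (by rw [r1]; exact List.prefix_append _ _) (by rw [r2]; exact List.prefix_append _ _)
        (by rw [invRev_length]; exact hc)
      have hTu : T = invRev u := by rw [← hXnot, ← hd, hT']
      have hlen_eq : s.length = s2.length := by
        by_contra hne
        rcases lt_or_gt_of_ne hne with h | h
        · have := root_large hap (rot_sub h.le hrot) (by omega) (by rw [invRev_length]; omega)
          rw [invRev_length] at this; omega
        · have := root_large hap (rot_sub h.le hrot.symm) (by omega) (by rw [invRev_length]; omega)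
          rw [invRev_length] at this; omega
      have hss : invRev s2 = invRev s := by
        have h1 : invRev u = invRev s ++ invRev u1 := by rw [e1, invRev_append]
        have h2 := e4.symm.trans (hTu.trans h1)
        exact (List.append_inj h2 (by simp [invRev_length, hlen_eq])).1
      have hss2 : s2 = s := invRev_injective hss
      apply hx
      rw [gx, hss2, ← one_eq_mk]; group
    refine ⟨s.length + s3.length, s2.length + s3.length, [], by omega, by omega, by simp, ?_, ?_⟩
    · have t1 : u.take (ξ.toWord.length - (s.length + s3.length)) = u3 := by
        rw [e1, e5, List.append_assoc]; exact List.take_left' (by omega)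
      have t2 : T.drop (s2.length + s3.length) = T3 := by
        rw [e4, e6, ← List.append_assoc]; apply List.drop_left'; simp [invRev_length]
      rw [t1, t2]; simpa using hr3
    · have t1 : u.take (ξ.toWord.length - (s.length + s3.length)) = u3 := by
        rw [e1, e5, List.append_assoc]; exact List.take_left' (by omega)
      have t2 : T.take (s2.length + s3.length) = invRev s2 ++ invRev s3 := by
        rw [e4, e6, ← List.append_assoc]; apply List.take_left'; simp [invRev_length]
      rw [t1, t2, gu, gx, e5, ← mul_mk, ← mul_mk, ← mul_mk, ← inv_mk, ← inv_mk, ← one_eq_mk]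
      group
  · refine ⟨s.length, s2.length, x2, by omega, by omega, by omega, ?_, ?_⟩
    · have t1 : u.take (ξ.toWord.length - s.length) = u1 := by
        rw [e1]; exact List.take_left' (by omega)
      have t2 : T.drop s2.length = T2 := by
        rw [e4]; apply List.drop_left'; simp [invRev_length]
      rw [t1, t2]
      refine IsReduced.append_overlap ?_ hr2 hx2
      rw [e3, ← List.append_assoc] at hr1
      exact red_sub hr1 (List.prefix_append _ _).isInfix
    · have t1 : u.take (ξ.toWord.length - s.length) = u1 := by
        rw [e1]; exact List.take_left' (by omega)
      have t2 : T.take s2.length = invRev s2 := by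
        rw [e4]; apply List.take_left'; simp [invRev_length]
      rw [t1, t2, gu, gx, ← mul_mk, ← inv_mk]
      group

end


section
variable {α : Type*} [DecidableEq α]

theorem mk_take_add (w : List (α × Bool)) (b t : ℕ) :
    mk (w.take (b + t)) = mk (w.take b) * mk ((w.drop b).take t) := by
  rw [List.take_add, ← mul_mk]

theorem sprod_cons (ξ : FreeGroup α) (p : FreeGroup α × Bool) (l : List (FreeGroup α × Bool)) :
    sprod ξ (p :: l) = sg ξ p.2 * p.1 * sprod ξ l := by
  simp [sprod, sg]

/-- Prepend a value to a sequence. -/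
def ext0 (a : ℕ) (g : ℕ → ℕ) : ℕ → ℕ
  | 0 => a
  | i + 1 => g i

/-- Structure of the reduced form of the product. -/
structure Dec (ξ : FreeGroup α) (l : List (FreeGroup α × Bool)) (f S E : ℕ → ℕ) : Prop where
  S0 : S 0 = 0
  f0 : f 0 = 0
  fS : ∀ i < l.length, f i ≤ S i
  Sf : ∀ i < l.length, S i ≤ f i + (ξ.toWord.length / 5 + 192)
  fE : ∀ i < l.length, f i + ξ.toWord.length ≤ E i + (ξ.toWord.length / 5 + 192)
  Ef : ∀ i < l.length, E i ≤ f i + ξ.toWord.length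
  ES : ∀ i, i + 1 < l.length → E i ≤ S (i + 1)
  SE : ∀ i, i + 1 < l.length → S (i + 1) ≤ E i + 192
  El : E (l.length - 1) ≤ (sprod ξ l).toWord.length
  lE : (sprod ξ l).toWord.length ≤ E (l.length - 1) + 192
  pt : ∀ i (h : i < l.length), ∀ s, S i ≤ s → s ≤ E i →
    sprod ξ (l.take i) * mk ((sg ξ l[i].2).toWord.take (s - f i)) =
      mk ((sprod ξ l).toWord.take s)

theorem exists_dec {ξ : FreeGroup α} (H : Hyp ξ) (l : List (FreeGroup α × Bool)) (hne : l ≠ [])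
    (hx : ∀ p ∈ l, p.1 ≠ 1 ∧ p.1.toWord.length ≤ 192) : ∃ f S E, Dec ξ l f S E := by
  have hn := H.hlen
  induction l with
  | nil => exact absurd rfl hne
  | cons p l ih =>
    by_cases hl : l = []
    · subst hl
      have hxl := (hx p (by simp)).2
      obtain ⟨u1, s, x1, e1, e2, hr⟩ := cancel p.1.toWord (sg ξ p.2).toWord isReduced_toWord
        isReduced_toWord
      have hlu := X_len ξ p.2
      have l1 := congrArg List.length e1
      have l2 := congrArg List.length e2
      simp only [List.length_append, invRev_length] at l1 l2
      have hw : (sprod ξ [p]).toWord = u1 ++ x1 := by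
        rw [← toWord_of_reduced hr]
        congr 1
        rw [sprod_cons]
        simp only [sprod, List.map_nil, List.prod_nil, mul_one]
        rw [← mk_toWord (x := sg ξ p.2), ← mk_toWord (x := p.1), e1, e2, ← mul_mk, ← mul_mk,
          ← mul_mk, ← inv_mk]
        group
      refine ⟨fun _ => 0, fun _ => 0, fun _ => u1.length, rfl, rfl, ?_, ?_, ?_, ?_, ?_, ?_, ?_, ?_, ?_⟩
      · intro i _; omega
      · intro i _; omega
      · intro i _; omega
      · intro i _; omega
      · intro i h; simp at h
      · intro i h; simp at h
      · rw [hw]; simp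
      · rw [hw]; simp; omega
      · intro i h s' _ hs'
        have : i = 0 := by simpa using h
        subst this
        rw [hw]
        simp only [List.take_zero, sprod, List.map_nil, List.prod_nil, one_mul,
          List.getElem_cons_zero, Nat.sub_zero, e1]
        rw [List.take_append_of_le_length hs', List.take_append_of_le_length hs']
    · obtain ⟨f, S, E, D⟩ := ih hl (fun q hq => hx q (List.mem_cons_of_mem _ hq))
      have hlpos : 0 < l.length := List.length_pos_iff.2 hl
      obtain ⟨a, b, r, ha, hb, hr, hred, hmk⟩ := junction H p.2 l[0].2 p.1
        (hx p (by simp)).1 (hx p (by simp)).2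
      have hE0 := D.fE 0 hlpos
      have hE0' := D.Ef 0 hlpos
      rw [D.f0] at hE0 hE0'
      set n := ξ.toWord.length with hndef
      have hlu := X_len ξ p.2
      have hlT := X_len ξ l[0].2
      rw [← hndef] at hlu hlT
      set w := (sprod ξ l).toWord with hw
      have hwl : E 0 ≤ w.length := by
        have hmono : ∀ i, i < l.length → E 0 ≤ E i := by
          intro i
          induction i with
          | zero => intro _; exact le_rfl
          | succ i ih2 =>
            intro hi
            have := ih2 (by omega)
            have h1 := D.ES i hi
            have h2 := D.Sf (i+1) hi
            have h3 := D.fE (i+1) hi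
            omega
        exact (hmono (l.length - 1) (by omega)).trans D.El
      have hwred : IsReduced w := isReduced_toWord
      have htake : ∀ s, s ≤ E 0 → w.take s = (sg ξ l[0].2).toWord.take s := by
        intro s hs
        apply eq_of_mk (red_take hwred _) (red_take isReduced_toWord _)
        have := D.pt 0 hlpos s (by rw [D.S0]; omega) hs
        rw [← this, D.f0]
        simp [sprod]
      have hw' : (sprod ξ (p :: l)).toWord =
          ((sg ξ p.2).toWord.take (n - a) ++ r) ++ w.drop b := by
        have hR : IsReduced (((sg ξ p.2).toWord.take (n - a) ++ r) ++ w.drop b) := by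
          have e : w.drop b = (w.take (E 0)).drop b ++ w.drop (E 0) := by
            conv_lhs => rw [← List.take_append_drop (E 0) w]
            rw [List.drop_append_of_le_length]
            simp; omega
          rw [e, ← List.append_assoc]
          refine IsReduced.append_overlap ?_ (by rw [← e]; exact red_drop hwred b) ?_
          · refine red_sub hred ?_
            rw [htake _ le_rfl, List.drop_take]
            refine List.IsPrefix.isInfix ?_
            rw [List.prefix_append_right_inj]
            exact List.take_prefix _ _
          · intro h0
            have := congrArg List.length h0
            simp at this
            omega
        rw [← toWord_of_reduced hR]
        congr 1
        rw [← mul_mk, hmk, sprod_cons, mul_assoc _ (mk _) (mk _), ← htake b (by omega), mul_mk,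
          List.take_append_drop, hw, mk_toWord]
      have hw'take : ∀ s, b ≤ s → mk ((sprod ξ (p :: l)).toWord.take (s + (n - a + r.length - b))) =
          sg ξ p.2 * p.1 * mk (w.take s) := by
        intro s hs
        have hl1 : ((sg ξ p.2).toWord.take (n - a) ++ r).length = n - a + r.length := by
          simp; omega
        have : s + (n - a + r.length - b) =
          ((sg ξ p.2).toWord.take (n - a) ++ r).length + (s - b) := by rw [hl1]; omega
        rw [this, hw', List.take_length_add_append, ← mul_mk, hmk, ← htake b (by omega), mul_assoc,
          ← mk_take_add]
        congr 4; omega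
      have hl' : (sprod ξ (p :: l)).toWord.length = n - a + r.length + (w.length - b) := by
        rw [hw']; simp; omega
      refine ⟨ext0 0 (fun i => f i + (n - a + r.length - b)),
        ext0 0 (fun i => max (S i) b + (n - a + r.length - b)),
        ext0 (n - a) (fun i => E i + (n - a + r.length - b)),
        rfl, rfl, ?_, ?_, ?_, ?_, ?_, ?_, ?_, ?_, ?_⟩
      · rintro (_ | i) hi
        · simp [ext0]
        · have := D.fS i (by simpa using hi)
          simp only [ext0]; omega
      · rintro (_ | i) hi
        · simp [ext0]
        · have := D.Sf i (by simpa using hi)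
          simp only [ext0]; omega
      · rintro (_ | i) hi
        · simp only [ext0]; omega
        · have := D.fE i (by simpa using hi)
          simp only [ext0]; omega
      · rintro (_ | i) hi
        · simp only [ext0]; omega
        · have := D.Ef i (by simpa using hi)
          simp only [ext0]; omega
      · rintro (_ | i) hi
        · simp only [ext0]; rw [D.S0]; omega
        · have := D.ES i (by simpa using hi)
          simp only [ext0]; omega
      · rintro (_ | i) hi
        · simp only [ext0]; rw [D.S0]; omega
        · have := D.SE i (by simpa using hi)
          have h2 := D.fE i (by simp at hi; omega)
          simp only [ext0]; omega
      · have h1 : E (l.length - 1) ≤ w.length := D.El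
        obtain ⟨m, hm⟩ : ∃ m, l.length = m + 1 := ⟨l.length - 1, by omega⟩
        rw [hl', List.length_cons, hm]
        rw [hm] at h1
        simp only [Nat.add_sub_cancel, ext0] at h1 ⊢
        omega
      · have h1 : w.length ≤ E (l.length - 1) + 192 := D.lE
        obtain ⟨m, hm⟩ : ∃ m, l.length = m + 1 := ⟨l.length - 1, by omega⟩
        rw [hl', List.length_cons, hm]
        rw [hm] at h1
        simp only [Nat.add_sub_cancel, ext0] at h1 ⊢
        omega
      · rintro (_ | i) hi s hs1 hs2
        · simp only [ext0] at hs2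
          rw [hw', List.append_assoc, List.take_append_of_le_length (by simp; omega), List.take_take,
            min_eq_left hs2]
          simp [sprod, ext0]
        · have hi' : i < l.length := by simpa using hi
          simp only [ext0] at hs1 hs2 ⊢
          obtain ⟨t, rfl⟩ : ∃ t, s = t + (n - a + r.length - b) :=
            ⟨s - (n - a + r.length - b), by omega⟩
          rw [hw'take t (by omega), ← D.pt i hi' t (by omega) (by omega), List.take_succ_cons,
            sprod_cons]
          simp only [List.getElem_cons_succ, mul_assoc]
          congr 5; omega

end


section
variable {α : Type*} [DecidableEq α]

theorem invRev_take (v : List (α × Bool)) (d : ℕ) :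
    (invRev v).take d = invRev (v.drop (v.length - d)) := by
  by_cases hd : d ≤ v.length
  · conv_lhs => rw [← List.take_append_drop (v.length - d) v, invRev_append]
    apply List.take_left'
    simp [invRev_length]; omega
  · rw [List.take_of_length_le (by rw [invRev_length]; omega),
      show v.length - d = 0 by omega, List.drop_zero]

theorem invRev_drop (v : List (α × Bool)) (d : ℕ) (hd : d ≤ v.length) :
    (invRev v).drop (v.length - d) = invRev (v.take d) := by
  conv_lhs => rw [← List.take_append_drop d v, invRev_append]
  apply List.drop_left'
  simp [invRev_length]

/-- Elements of the centralizer of `ξ` which come from coincidences of cyclic shifts. -/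
def Good (ξ u : FreeGroup α) : Prop :=
  Commute u ξ ∧ ∃ (σ : Bool) (d : ℕ), u = mk ((sg ξ σ).toWord.take d) ∧
    u = mk ((sg ξ σ).toWord.drop (ξ.toWord.length - d)) ∧ d ≤ ξ.toWord.length ∧
    (d = 0 ∨ ξ.toWord.length ≤ 3 * d)

theorem Good.inv {ξ u : FreeGroup α} (h : Good ξ u) : Good ξ u⁻¹ := by
  obtain ⟨hc, σ, d, h1, h2, h3, h4⟩ := h
  refine ⟨hc.inv_left, !σ, d, ?_, ?_, h3, h4⟩
  · rw [X_not, invRev_take, X_len, ← inv_mk, ← h2]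
  · rw [X_not, ← X_len ξ σ, invRev_drop _ _ (by rw [X_len]; exact h3), ← inv_mk, ← h1]

theorem good_of_rot_le {ξ : FreeGroup α} (H : Hyp ξ) (ε : Bool) {s s' : ℕ} (hs : s ≤ s')
    (hs' : s' < ξ.toWord.length)
    (hrot : (sg ξ ε).toWord.rotate s = (sg ξ ε).toWord.rotate s') :
    Good ξ (mk ((sg ξ ε).toWord.take s') * (mk ((sg ξ ε).toWord.take s))⁻¹) := by
  have hd := rot_sub hs hrot
  have hlv := X_len ξ ε
  have hmk : mk (sg ξ ε).toWord = sg ξ ε := mk_toWord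
  have hap := X_ap H ε
  generalize hv : (sg ξ ε).toWord = v at *
  obtain ⟨d, rfl⟩ : ∃ d, s' = d + s := ⟨s' - s, by omega⟩
  rw [Nat.add_sub_cancel] at hd
  have hd2 := hd
  rw [List.rotate_eq_drop_append_take (by omega)] at hd2
  have e1 : v.take (v.length - d) = v.drop d := by
    have h := congrArg (List.take (v.length - d)) hd2
    rw [List.take_left' (by simp)] at h
    exact h.symm
  have e2 : v.drop (v.length - d) = v.take d := by
    have h := congrArg (List.drop (v.length - d)) hd2
    rw [List.drop_left' (by simp)] at h
    exact h.symm
  have e3 : mk (v.take (d + s)) * (mk (v.take s))⁻¹ = mk (v.take d) := by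
    rw [mk_take_add, ← e1, List.take_take, min_eq_left (by omega)]
    group
  rw [e3]
  refine ⟨?_, ε, d, by rw [hv], by rw [hv, ← hlv, e2], by omega, ?_⟩
  · have hcom : Commute (mk (v.take d)) (sg ξ ε) := by
      have h1 : mk v = mk (v.take d) * mk (v.drop d) := by
        rw [mul_mk, List.take_append_drop]
      have h2 : mk v = mk (v.drop d) * mk (v.take d) := by
        rw [mul_mk, hd2]
      rw [← hmk]
      unfold Commute SemiconjBy
      nth_rewrite 1 [h2]
      rw [h1, mul_assoc]
    revert hcom
    cases ε
    · rw [show sg ξ false = ξ⁻¹ by simp [sg]]; exact Commute.inv_right_iff.1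
    · exact id
  · by_cases h0 : d = 0
    · exact Or.inl h0
    · right
      rw [← hlv]
      exact root_large hap hd (by omega) (by omega)

theorem good_of_rot {ξ : FreeGroup α} (H : Hyp ξ) (ε : Bool) {s s' : ℕ}
    (hs : s < ξ.toWord.length) (hs' : s' < ξ.toWord.length)
    (hrot : (sg ξ ε).toWord.rotate s = (sg ξ ε).toWord.rotate s') :
    Good ξ (mk ((sg ξ ε).toWord.take s') * (mk ((sg ξ ε).toWord.take s))⁻¹) := by
  rcases le_total s s' with h | h
  · exact good_of_rot_le H ε h hs' hrot
  · have := (good_of_rot_le H ε h hs hrot.symm).inv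
    simpa using this

theorem norm_eq_of_red {u : List (α × Bool)} (hu : IsReduced u) : (mk u).norm = u.length := by
  rw [FreeGroup.norm, toWord_of_reduced hu]

theorem rigid {ξ : FreeGroup α} (H : Hyp ξ) {x u u' : FreeGroup α} (hx : x ≠ 1)
    (hxl : x.norm ≤ 192) (hu : Good ξ u) (hu' : Good ξ u') (hl : (u * x * u').norm ≤ 192) :
    u = 1 ∧ u' = 1 := by
  obtain ⟨-, σ, d, h1, h2, h3, h4⟩ := hu
  obtain ⟨-, σ', d', h1', h2', h3', h4'⟩ := hu'
  have hn := H.hlen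
  have hX := X_len ξ σ
  have hX' := X_len ξ σ'
  have nu : u.norm = d := by
    rw [h1, norm_eq_of_red (red_take isReduced_toWord _)]; simp; omega
  have nu' : u'.norm = d' := by
    rw [h1', norm_eq_of_red (red_take isReduced_toWord _)]; simp; omega
  by_cases hd : d = 0
  · have hu1 : u = 1 := norm_eq_zero.1 (by omega)
    have : u'.norm ≤ 192 + 192 := by
      have e : u' = x⁻¹ * (u * x * u') := by rw [hu1]; group
      rw [e]
      refine (FreeGroup.norm_mul_le _ _).trans ?_
      rw [norm_inv_eq]; omega
    exact ⟨hu1, norm_eq_zero.1 (by omega)⟩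
  · by_cases hd' : d' = 0
    · have hu1 : u' = 1 := norm_eq_zero.1 (by omega)
      have : u.norm ≤ 192 + 192 := by
        have e : u = (u * x * u') * x⁻¹ := by rw [hu1]; group
        rw [e]
        refine (FreeGroup.norm_mul_le _ _).trans ?_
        rw [norm_inv_eq]; omega
      exact ⟨norm_eq_zero.1 (by omega), hu1⟩
    · exfalso
      obtain ⟨a, b, r, ha, hb, hr, hred, hmk⟩ := junction H σ σ' x hx hxl
      set n := ξ.toWord.length
      set X := (sg ξ σ).toWord with hXd
      set X' := (sg ξ σ').toWord
      have g1 : sg ξ σ = mk (X.take (n - d)) * u := by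
        rw [h2, mul_mk, List.take_append_drop, hXd, mk_toWord]
      have g2 : mk (X.take (n - a)) = mk (X.take (n - d)) * mk ((X.drop (n - d)).take (d - a)) := by
        rw [← mk_take_add]; congr 2; omega
      have g3 : u' = mk (X'.take b) * mk ((X'.drop b).take (d' - b)) := by
        rw [← mk_take_add, h1']; congr 2; omega
      have g4 : u * x * u' = mk ((X.drop (n - d)).take (d - a) ++ r ++ (X'.drop b).take (d' - b)) := by
        rw [← mul_mk] at hmk
        rw [← mul_mk, ← mul_mk, g3]
        rw [g1, g2] at hmk
        have : u * x * mk (X'.take b) = mk ((X.drop (n - d)).take (d - a)) * mk r := by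
          apply mul_left_cancel (a := mk (X.take (n - d)))
          simp only [← mul_assoc]
          exact hmk.symm
        rw [← mul_assoc, this]
      have hR : IsReduced ((X.drop (n - d)).take (d - a) ++ r ++ (X'.drop b).take (d' - b)) := by
        refine red_sub hred ⟨X.take (n - d), (X'.drop b).drop (d' - b), ?_⟩
        have : X.take (n - a) = X.take (n - d) ++ (X.drop (n - d)).take (d - a) := by
          rw [← List.take_add]; congr 1; omega
        rw [this]
        conv_rhs => rw [← List.take_append_drop (d' - b) (X'.drop b)]
        simp only [List.append_assoc]
      rw [g4, norm_eq_of_red hR] at hl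
      simp at hl
      omega

theorem not_commute {ξ : FreeGroup α} (H : Hyp ξ) {x : FreeGroup α} (hx : x ≠ 1)
    (hxl : x.norm ≤ 192) (hc : Commute x ξ) : False := by
  obtain ⟨a, b, r, ha, hb, hr, hred, hmk⟩ := junction H false true x hx hxl
  have hn := H.hlen
  have e : x = mk ((sg ξ false).toWord.take (ξ.toWord.length - a) ++ r ++
      (sg ξ true).toWord.drop b) := by
    rw [← mul_mk, hmk, mul_assoc, mul_mk, List.take_append_drop, mk_toWord]
    simp only [sg]
    have : x * ξ = ξ * x := hc
    simp [mul_assoc, this]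
  rw [e, norm_eq_of_red hred] at hxl
  have h1 := X_len ξ false
  have h2 := X_len ξ true
  simp at hxl
  omega

end


section
variable {α : Type*} [DecidableEq α]

/-- The `i`-th entry of the list. -/
def ent (l : List (FreeGroup α × Bool)) (i : ℕ) : FreeGroup α × Bool := l[i]?.getD (1, true)

theorem ent_eq (l : List (FreeGroup α × Bool)) (i : ℕ) (h : i < l.length) : ent l i = l[i] := by
  simp [ent, h]

/-- The context of the main argument: a long periodic stretch in the reduced product. -/
structure Ctx (ξ : FreeGroup α) (l : List (FreeGroup α × Bool)) (f S E : ℕ → ℕ)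
    (h : FreeGroup α) (v p : ℕ) : Prop where
  H : Hyp ξ
  D : Dec ξ l f S E
  hne : 0 < l.length
  hx : ∀ p ∈ l, p.1 ≠ 1 ∧ p.1.toWord.length ≤ 192
  hp : 0 < p
  hv : v + 501 * p ≤ (sprod ξ l).toWord.length
  shift : ∀ s, v ≤ s → s ≤ v + 500 * p →
    h * mk ((sprod ξ l).toWord.take s) = mk ((sprod ξ l).toWord.take (s + p))

namespace Ctx
variable {ξ : FreeGroup α} {l : List (FreeGroup α × Bool)} {f S E : ℕ → ℕ}
  {h : FreeGroup α} {v p : ℕ}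

theorem pt (C : Ctx ξ l f S E h v p) {i s : ℕ} (hi : i < l.length) (h1 : S i ≤ s) (h2 : s ≤ E i) :
    sprod ξ (l.take i) * FreeGroup.mk ((sg ξ (ent l i).2).toWord.take (s - f i)) =
      FreeGroup.mk ((sprod ξ l).toWord.take s) := by
  rw [ent_eq l i hi]; exact C.D.pt i hi s h1 h2

theorem g_succ (_C : Ctx ξ l f S E h v p) {i : ℕ} (hi : i < l.length) :
    sprod ξ (l.take (i + 1)) = sprod ξ (l.take i) * (sg ξ (ent l i).2 * (ent l i).1) := by
  rw [List.take_succ_eq_append_getElem hi, ent_eq l i hi]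
  simp only [sprod, sg, List.map_append, List.prod_append, List.map_cons, List.map_nil,
    List.prod_cons, List.prod_nil, mul_one]

theorem xne (C : Ctx ξ l f S E h v p) {i : ℕ} (hi : i < l.length) : (ent l i).1 ≠ 1 := by
  rw [ent_eq l i hi]; exact (C.hx _ (List.getElem_mem hi)).1

theorem xle (C : Ctx ξ l f S E h v p) {i : ℕ} (hi : i < l.length) : (ent l i).1.norm ≤ 192 := by
  rw [ent_eq l i hi]; exact (C.hx _ (List.getElem_mem hi)).2

theorem len (C : Ctx ξ l f S E h v p) {i : ℕ} (hi : i < l.length) :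
    S i + ξ.toWord.length ≤ E i + 2 * (ξ.toWord.length / 5 + 192) := by
  have := C.D.Sf i hi
  have := C.D.fE i hi
  omega

theorem ord (C : Ctx ξ l f S E h v p) {i j : ℕ} (hij : i < j) (hj : j < l.length) : E i ≤ S j := by
  have hn := C.H.hlen
  induction j with
  | zero => omega
  | succ j ih =>
    rcases Nat.lt_succ_iff_lt_or_eq.1 hij with h' | h'
    · have := ih h' (by omega)
      have := C.len (i := j) (by omega)
      have := C.D.ES j hj
      omega
    · subst h'; exact C.D.ES i hj

theorem Emono (C : Ctx ξ l f S E h v p) {i j : ℕ} (hij : i ≤ j) (hj : j < l.length) : E i ≤ E j := by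
  have hn := C.H.hlen
  rcases hij.lt_or_eq with h' | h'
  · have := C.ord h' hj
    have := C.len hj
    omega
  · subst h'; exact le_rfl

theorem fmono (C : Ctx ξ l f S E h v p) {i j : ℕ} (hij : i < j) (hj : j < l.length) : f i < f j := by
  have hn := C.H.hlen
  have := C.ord hij hj
  have := C.D.Sf j hj
  have := C.D.fE i (by omega)
  omega

theorem finj (C : Ctx ξ l f S E h v p) {i j : ℕ} (hi : i < l.length) (hj : j < l.length)
    (hf : f i = f j) : i = j := by
  rcases lt_trichotomy i j with h' | h' | h'
  · have := C.fmono h' hj; omega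
  · exact h'
  · have := C.fmono h' hi; omega

theorem small (C : Ctx ξ l f S E h v p) {j s : ℕ} (hj : j < l.length) (h1 : v ≤ s)
    (h2 : s + 4 * p ≤ v + 501 * p) (h3 : S j ≤ s) (h4 : s + 4 * p ≤ E j) : False := by
  have hfS := C.D.fS j hj
  have hEf := C.D.Ef j hj
  have hp := C.hp
  refine no_block (X_ap C.H (ent l j).2) (s - f j) p C.hp (by rw [X_len]; omega) ?_
  intro t ht1 ht2
  apply eq_of_mk (red_take (red_drop isReduced_toWord _) _)
    (red_take (red_drop isReduced_toWord _) _)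
  have e0 := mk_take_add (sg ξ (ent l j).2).toWord t p
  have e1 := mk_take_add (sg ξ (ent l j).2).toWord (t + p) p
  have q0 := C.pt hj (s := f j + t) (by omega) (by omega)
  have q1 := C.pt hj (s := f j + t + p) (by omega) (by omega)
  have q2 := C.pt hj (s := f j + t + p + p) (by omega) (by omega)
  have r0 := C.shift (f j + t) (by omega) (by omega)
  have r1 := C.shift (f j + t + p) (by omega) (by omega)
  rw [show f j + t - f j = t by omega] at q0
  rw [show f j + t + p - f j = t + p by omega] at q1
  rw [show f j + t + p + p - f j = t + p + p by omega] at q2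
  rw [← q0, ← q1] at r0
  rw [← q1, ← q2, e1, ← mul_assoc (sprod ξ _) _ (FreeGroup.mk (List.take p _)), ← r0,
    mul_assoc h] at r1
  have r2 := mul_left_cancel r1
  rw [r0, e0, mul_assoc] at r2
  exact (mul_left_cancel (mul_left_cancel r2)).symm

theorem cover (C : Ctx ξ l f S E h v p) {s e : ℕ}
    (h1 : s + (2 * (ξ.toWord.length / 5 + 1) + 192) ≤ e) (h2 : e ≤ (sprod ξ l).toWord.length) :
    ∃ j < l.length, s + (ξ.toWord.length / 5 + 1) ≤ E j ∧ S j + (ξ.toWord.length / 5 + 1) ≤ e := by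
  have hex : ∃ j, j < l.length ∧ s + (ξ.toWord.length / 5 + 1) ≤ E j := by
    have hne := C.hne
    refine ⟨l.length - 1, by omega, ?_⟩
    have := C.D.lE
    omega
  classical
  obtain ⟨hj1, hj2⟩ := Nat.find_spec hex
  have hmin := fun m => @Nat.find_min _ _ hex m
  generalize Nat.find hex = j at *
  refine ⟨j, hj1, hj2, ?_⟩
  rcases j with _ | j
  · rw [C.D.S0]; omega
  · have hm := hmin j (by omega)
    have := C.D.SE j hj1
    have : ¬ s + (ξ.toWord.length / 5 + 1) ≤ E j := fun hc => hm ⟨by omega, hc⟩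
    omega

theorem align (C : Ctx ξ l f S E h v p) {i j : ℕ} (hi : i < l.length) (hj : j < l.length)
    (hv1 : v ≤ S i) (hv2 : E i ≤ v + 500 * p)
    (R1 : S i + p + (ξ.toWord.length / 5 + 1) ≤ E j)
    (R2 : S j + (ξ.toWord.length / 5 + 1) ≤ E i + p) :
    (ent l j).2 = (ent l i).2 ∧ ∃ u, Good ξ u ∧
      h * sprod ξ (l.take i) = sprod ξ (l.take j) * u := by
  have hn := C.H.hlen
  have hli := C.len hi
  have hlj := C.len hj
  have a1 := C.D.fS i hi
  have a2 := C.D.fS j hj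
  have a3 := C.D.Ef i hi
  have a4 := C.D.Ef j hj
  obtain ⟨τ, hτ⟩ : ∃ τ, τ = ξ.toWord.length / 5 + 1 := ⟨_, rfl⟩
  rw [← hτ] at R1 R2
  obtain ⟨s1, hs1⟩ : ∃ s1, s1 + p = max (S i + p) (S j) := ⟨max (S i + p) (S j) - p, by omega⟩
  obtain ⟨A, hA⟩ : ∃ A, A = s1 - f i := ⟨_, rfl⟩
  obtain ⟨B, hB⟩ : ∃ B, B = s1 + p - f j := ⟨_, rfl⟩
  have q0 := C.pt hi (s := s1) (by omega) (by omega)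
  have q1 := C.pt hi (s := s1 + τ) (by omega) (by omega)
  have q2 := C.pt hj (s := s1 + p) (by omega) (by omega)
  have q3 := C.pt hj (s := s1 + τ + p) (by omega) (by omega)
  rw [← hA] at q0
  rw [show s1 + τ - f i = A + τ by omega, mk_take_add] at q1
  rw [← hB] at q2
  rw [show s1 + τ + p - f j = B + τ by omega, mk_take_add] at q3
  have r0 := C.shift s1 (by omega) (by omega)
  have r1 := C.shift (s1 + τ) (by omega) (by omega)
  rw [← q0, ← q2] at r0
  rw [← q1, ← q3] at r1
  simp only [← mul_assoc] at r0 r1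
  rw [r0] at r1
  have hblock := eq_of_mk (red_take (red_drop isReduced_toWord _) _)
    (red_take (red_drop isReduced_toWord _) _) (mul_left_cancel r1)
  have hXi := X_len ξ (ent l i).2
  have hXj := X_len ξ (ent l j).2
  obtain ⟨hε, hrot⟩ := piece C.H (ε := (ent l i).2) (δ := (ent l j).2) (i := A) (j := B)
    (P := ((sg ξ (ent l i).2).toWord.drop A).take τ)
    (by
      rw [List.rotate_eq_drop_append_take (by omega)]
      exact (List.take_prefix _ _).trans (List.prefix_append _ _))
    (by
      rw [List.rotate_eq_drop_append_take (by omega), hblock]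
      exact (List.take_prefix _ _).trans (List.prefix_append _ _))
    (by simp; omega)
  refine ⟨hε, _, good_of_rot C.H _ (by omega) (by omega) hrot, ?_⟩
  rw [hε] at r0
  rw [← mul_assoc, ← r0]
  group

theorem f_eq (C : Ctx ξ l f S E h v p) {i j : ℕ} (hi : i < l.length) (hj : j < l.length)
    (hv1 : v ≤ S i) (hv2 : E i ≤ v + 500 * p) (hε : (ent l j).2 = (ent l i).2)
    (hg : h * sprod ξ (l.take i) = sprod ξ (l.take j)) : f j = f i + p := by
  have hn := C.H.hlen
  have b1 := C.D.Sf i hi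
  have b2 := C.D.Sf j hj
  have b3 := C.D.fE i hi
  have b4 := C.D.fE j hj
  obtain ⟨c, hc⟩ : ∃ c, c = ξ.toWord.length / 5 + 192 := ⟨_, rfl⟩
  have hEl : E j ≤ (sprod ξ l).toWord.length :=
    (C.Emono (by omega : j ≤ l.length - 1) (by omega)).trans C.D.El
  have hv := C.hv
  have q0 := C.pt hi (s := f i + c) (by omega) (by omega)
  have q1 := C.pt hj (s := f j + c) (by omega) (by omega)
  rw [Nat.add_sub_cancel_left] at q0 q1
  have r0 := C.shift (f i + c) (by omega) (by omega)
  rw [← q0, ← mul_assoc, hg, ← hε, q1] at r0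
  have := congrArg FreeGroup.norm r0
  rw [norm_eq_of_red (red_take isReduced_toWord _), norm_eq_of_red (red_take isReduced_toWord _)]
    at this
  simp at this
  omega

theorem sg_comm {ξ u : FreeGroup α} (hu : Commute u ξ) (ε : Bool) : Commute u (sg ξ ε) := by
  cases ε
  · rw [show sg ξ false = ξ⁻¹ by simp [sg]]; exact hu.inv_right
  · exact hu

theorem step (C : Ctx ξ l f S E h v p) {i : ℕ} (hi : i + 1 < l.length)
    (hv1 : v ≤ S i) (hv2 : E (i + 1) ≤ v + 500 * p) :
    ∃ j, j + 1 < l.length ∧ f j = f i + p ∧ f (j + 1) = f (i + 1) + p ∧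
      (ent l i).1 = (ent l j).1 := by
  have hn := C.H.hlen
  have hv := C.hv
  have hi0 : i < l.length := by omega
  have hli := C.len hi0
  have hli1 := C.len hi
  have hES := C.D.ES i hi
  obtain ⟨τ, hτ⟩ : ∃ τ, τ = ξ.toWord.length / 5 + 1 := ⟨_, rfl⟩
  have hcov := @cover _ _ _ _ _ _ _ _ _ _ C
  have halign := @align _ _ _ _ _ _ _ _ _ _ C
  rw [← hτ] at hcov halign
  -- the largest `j` aligned with `i`
  obtain ⟨j, ⟨hj, R1, R2⟩, hmax⟩ : ∃ j, (j < l.length ∧ S i + p + τ ≤ E j ∧ S j + τ ≤ E i + p) ∧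
      ∀ k, (k < l.length ∧ S i + p + τ ≤ E k ∧ S k + τ ≤ E i + p) → k ≤ j := by
    obtain ⟨j, hj⟩ := hcov (s := S i + p) (e := E i + p) (by omega) (by omega)
    classical
    have hs := Nat.findGreatest_spec (P := fun k => k < l.length ∧ S i + p + τ ≤ E k ∧
      S k + τ ≤ E i + p) (n := l.length) hj.1.le hj
    exact ⟨_, hs, fun k hk => Nat.le_findGreatest hk.1.le hk⟩
  obtain ⟨j', ⟨hj', R1', R2'⟩, hmin⟩ : ∃ j', (j' < l.length ∧ S (i + 1) + p + τ ≤ E j' ∧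
      S j' + τ ≤ E (i + 1) + p) ∧ ∀ k, (k < l.length ∧ S (i + 1) + p + τ ≤ E k ∧
      S k + τ ≤ E (i + 1) + p) → j' ≤ k := by
    have hex := hcov (s := S (i + 1) + p) (e := E (i + 1) + p) (by omega) (by omega)
    classical
    exact ⟨Nat.find hex, Nat.find_spec hex, fun k hk => Nat.find_min' hex hk⟩
  obtain ⟨hε, u, hu, hgu⟩ := halign hi0 hj hv1 (by omega) R1 R2
  obtain ⟨hε', u', hu', hgu'⟩ := halign hi hj' (by omega) hv2 R1' R2'
  have hjj : j ≤ j' := by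
    by_contra hc
    have := C.ord (i := j') (j := j) (by omega) hj
    omega
  have hjne : j ≠ j' := by
    rintro rfl
    have e1 : sprod ξ (l.take j) * u' =
        sprod ξ (l.take j) * (u * (sg ξ (ent l i).2 * (ent l i).1)) := by
      rw [← hgu', C.g_succ hi0, ← mul_assoc, hgu, mul_assoc]
    have e2 := mul_left_cancel e1
    have e3 : (ent l i).1 = (sg ξ (ent l i).2)⁻¹ * (u⁻¹ * u') := by rw [e2]; group
    apply not_commute C.H (C.xne hi0) (C.xle hi0)
    rw [e3]
    have h1 : Commute (sg ξ (ent l i).2) ξ := (sg_comm (Commute.refl ξ) _).symm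
    exact h1.inv_left.mul_left (hu.1.inv_left.mul_left hu'.1)
  have hj1 : j' = j + 1 := by
    by_contra hc
    have hj1l : j + 1 < l.length := by omega
    have o1 := C.ord (i := j) (j := j + 1) (by omega) hj1l
    have o2 := C.ord (i := j + 1) (j := j') (by omega) hj'
    have hlj1 := C.len hj1l
    have hlj' := C.len hj'
    have hEl : E (j + 1) ≤ (sprod ξ l).toWord.length :=
      (C.Emono (by omega : j + 1 ≤ l.length - 1) (by omega)).trans C.D.El
    obtain ⟨k, hk, K1, K2⟩ := hcov (s := S (j + 1) - p) (e := E (j + 1) - p) (by omega) (by omega)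
    have hki : i ≤ k := by
      by_contra hc2
      have := C.ord (i := k) (j := i) (by omega) hi0
      omega
    have hki1 : k ≤ i + 1 := by
      by_contra hc2
      have := C.ord (i := i + 1) (j := k) (by omega) hk
      omega
    rcases (by omega : k = i ∨ k = i + 1) with rfl | rfl
    · have := hmax (j + 1) ⟨hj1l, by omega, by omega⟩
      omega
    · have := hmin (j + 1) ⟨hj1l, by omega, by omega⟩
      omega
  subst hj1
  have hxeq : u * (ent l i).1 * u'⁻¹ = (ent l j).1 := by
    have e1 : sprod ξ (l.take j) * (sg ξ (ent l j).2 * ((ent l j).1 * u')) =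
        sprod ξ (l.take j) * (u * (sg ξ (ent l i).2 * (ent l i).1)) := by
      have : sprod ξ (l.take j) * (sg ξ (ent l j).2 * ((ent l j).1 * u')) =
        sprod ξ (l.take (j + 1)) * u' := by rw [C.g_succ hj]; group
      rw [this, ← hgu', C.g_succ hi0, ← mul_assoc, hgu, mul_assoc]
    have e2 := mul_left_cancel e1
    rw [hε, ← mul_assoc u, (sg_comm hu.1 _).eq, mul_assoc] at e2
    rw [← mul_left_cancel e2]
    group
  obtain ⟨hu1, hu1'⟩ := rigid C.H (C.xne hi0) (C.xle hi0) hu hu'.inv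
    (by rw [hxeq]; exact C.xle hj)
  have hu1'' : u' = 1 := by simpa using hu1'
  rw [hu1, mul_one] at hgu
  rw [hu1'', mul_one] at hgu'
  refine ⟨j, hj', C.f_eq hi0 hj hv1 (by omega) hε hgu, C.f_eq hi hj' (by omega) hv2 hε' hgu', ?_⟩
  rw [← hxeq, hu1, hu1'']; simp

end Ctx

end


section
variable {α : Type*} [DecidableEq α]

namespace Ctx
variable {ξ : FreeGroup α} {l : List (FreeGroup α × Bool)} {f S E : ℕ → ℕ}
  {h : FreeGroup α} {v p : ℕ}

theorem start (C : Ctx ξ l f S E h v p) :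
    ∃ i, i < l.length ∧ v ≤ S i ∧ S i ≤ v + 4 * p + 192 ∧ E i < S i + 4 * p := by
  have hp := C.hp
  have hv := C.hv
  have hne := C.hne
  have hn := C.H.hlen
  have hex : ∃ i, i < l.length ∧ v ≤ S i := by
    by_contra hc
    push Not at hc
    have h1 := hc (l.length - 1) (by omega)
    have hlE := C.D.lE
    have hli := C.len (i := l.length - 1) (by omega)
    by_cases h4 : v + 4 * p ≤ E (l.length - 1)
    · exact C.small (j := l.length - 1) (s := v) (by omega) le_rfl (by omega) (by omega) h4
    · omega
  classical
  obtain ⟨hj1, hj2⟩ := Nat.find_spec hex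
  have hmin := fun m => @Nat.find_min _ _ hex m
  generalize Nat.find hex = j at *
  have hS : S j ≤ v + 4 * p + 192 := by
    rcases j with _ | j
    · rw [C.D.S0]; omega
    · have hm := hmin j (by omega)
      have := C.D.SE j hj1
      have h5 : ¬ v ≤ S j := fun hc => hm ⟨by omega, hc⟩
      by_cases h4 : v + 4 * p ≤ E j
      · exact (C.small (j := j) (s := v) (by omega) le_rfl (by omega) (by omega) h4).elim
      · omega
  refine ⟨j, hj1, hj2, hS, ?_⟩
  by_contra h4
  have hEl : E j ≤ (sprod ξ l).toWord.length :=
    (C.Emono (by omega : j ≤ l.length - 1) (by omega)).trans C.D.El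
  by_cases h6 : 192 ≤ 493 * p
  · exact C.small (j := j) (s := S j) hj1 hj2 (by omega) le_rfl (by omega)
  · omega

theorem next (C : Ctx ξ l f S E h v p) {i : ℕ} (hi : i < l.length) (hnp : ξ.toWord.length ≤ 8 * p)
    (hv1 : v ≤ S i) (hE : E i ≤ v + 400 * p) :
    ∃ j, j + 1 < l.length ∧ f j = f i + p ∧ f (j + 1) = f (i + 1) + p ∧ i + 1 < l.length ∧
      (ent l i).1 = (ent l j).1 := by
  have hn := C.H.hlen
  have hv := C.hv
  have hi1 : i + 1 < l.length := by
    by_contra hc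
    have : i = l.length - 1 := by omega
    have := C.D.lE
    subst i
    omega
  have := C.D.SE i hi1
  have := C.D.Ef _ hi1
  have := C.D.fS _ hi1
  obtain ⟨j, a, b, c, d⟩ := C.step hi1 hv1 (by omega)
  exact ⟨j, a, b, c, hi1, d⟩

theorem false_of (C : Ctx ξ l f S E h v p) (hseq : KAperiodic 10 (l.map Prod.fst)) : False := by
  have hn := C.H.hlen
  have hp := C.hp
  obtain ⟨i0, hi0, hvS, hSv, hES⟩ := C.start
  have hnp : ξ.toWord.length ≤ 8 * p := by
    have := C.len hi0
    omega
  have hE0 : E i0 ≤ v + 400 * p := by omega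
  have hSge : ∀ i, i0 ≤ i → i < l.length → v ≤ S i := by
    intro i h1 h2
    rcases h1.lt_or_eq with h3 | h3
    · have := C.ord h3 h2
      have := C.len hi0
      omega
    · subst h3; exact hvS
  obtain ⟨j0, b1, b2, b3, b4, b5⟩ := C.next hi0 hnp hvS hE0
  have hj0 : i0 < j0 := by
    by_contra hc
    rcases (not_lt.1 hc).lt_or_eq with h3 | h3
    · have := C.fmono h3 hi0; omega
    · subst h3; omega
  obtain ⟨q, rfl⟩ : ∃ q, j0 = i0 + q := ⟨j0 - i0, by omega⟩
  have hq : 0 < q := by omega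
  have claim : ∀ k, i0 + k < l.length → E (i0 + k) ≤ v + 400 * p →
      i0 + k + q + 1 < l.length ∧ f (i0 + k + q) = f (i0 + k) + p ∧
      f (i0 + k + q + 1) = f (i0 + k + 1) + p ∧
      (ent l (i0 + k)).1 = (ent l (i0 + k + q)).1 := by
    intro k
    induction k with
    | zero => intro _ _; exact ⟨b1, b2, b3, b5⟩
    | succ k ih =>
      intro hk hEk
      obtain ⟨c1, c2, c3, c4⟩ := ih (by omega)
        ((C.Emono (i := i0 + k) (j := i0 + (k + 1)) (by omega) hk).trans hEk)
      obtain ⟨j, d1, d2, d3, d4, d5⟩ := C.next hk hnp (hSge _ (by omega) hk) hEk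
      have hj : j = i0 + k + q + 1 := C.finj (by omega) c1 (by rw [d2, c3]; rfl)
      subst hj
      rw [show i0 + (k + 1) + q = i0 + k + q + 1 by omega]
      exact ⟨d1, d2, d3, d5⟩
  have hmul : ∀ a, a ≤ 11 → i0 + a * q < l.length ∧ f (i0 + a * q) = f i0 + a * p := by
    intro a
    induction a with
    | zero => intro _; simpa using hi0
    | succ a ih =>
      intro ha
      obtain ⟨c1, c2⟩ := ih (by omega)
      have := C.D.Ef _ c1
      have := C.D.fS _ hi0
      have hap : a * p ≤ 10 * p := Nat.mul_le_mul_right _ (by omega)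
      obtain ⟨d1, d2, -, -⟩ := claim (a * q) c1 (by omega)
      rw [show i0 + (a + 1) * q = i0 + a * q + q by ring]
      refine ⟨by omega, ?_⟩
      rw [d2, c2]; ring
  obtain ⟨m1, -⟩ := hmul 11 le_rfl
  obtain ⟨m2, m3⟩ := hmul 10 (by omega)
  have hE10 : E (i0 + 10 * q) ≤ v + 400 * p := by
    have := C.D.Ef _ m2
    have := C.D.fS _ hi0
    omega
  have hper := periodic_pow q 10 ((l.map Prod.fst).drop i0)
    (by simp only [List.length_drop, List.length_map]; omega) (by
      intro k hk
      have hkl : i0 + k < l.length := by omega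
      obtain ⟨d1, -, -, d4⟩ := claim k hkl
        ((C.Emono (by omega : i0 + k ≤ i0 + 10 * q) m2).trans hE10)
      have hkq : i0 + (k + q) < l.length := by omega
      rw [show i0 + k + q = i0 + (k + q) by omega, ent_eq l _ hkl, ent_eq l _ hkq] at d4
      rw [List.getElem?_drop, List.getElem?_drop, List.getElem?_map, List.getElem?_map,
        List.getElem?_eq_getElem hkl, List.getElem?_eq_getElem hkq]
      simp [d4])
  have hnil := hseq ((l.map Prod.fst).take i0) (((l.map Prod.fst).drop i0).take q)
    (((l.map Prod.fst).drop i0).drop ((10 + 1) * q)) (by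
      rw [← hper, List.append_assoc, List.take_append_drop, List.take_append_drop])
  have := congrArg List.length hnil
  simp only [List.length_take, List.length_drop, List.length_map, List.length_nil] at this
  omega

end Ctx

theorem len_pow {β : Type*} (Y : List β) (m : ℕ) :
    (List.replicate m Y).flatten.length = m * Y.length := by
  simp

theorem take_pow_succ {β : Type*} (Y : List β) (m t : ℕ) :
    (List.replicate (m + 1) Y).flatten.take (t + Y.length) =
      Y ++ ((List.replicate m Y).flatten.take t) := by
  rw [List.replicate_succ, List.flatten_cons, add_comm, List.take_length_add_append]

theorem take_pow_le {β : Type*} (Y : List β) (m t : ℕ) (h : t ≤ m * Y.length) :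
    (List.replicate (m + 1) Y).flatten.take t = (List.replicate m Y).flatten.take t := by
  rw [List.replicate_succ', List.flatten_append, List.take_append_of_le_length]
  simpa using h

theorem main {ξ : FreeGroup α} (H : Hyp ξ) (l : List (FreeGroup α × Bool)) (hne : l ≠ [])
    (hx : ∀ p ∈ l, p.1 ≠ 1 ∧ p.1.toWord.length ≤ 192)
    (hseq : KAperiodic 10 (l.map Prod.fst)) :
    KAperiodic 500 (sprod ξ l).toWord := by
  intro X Y Z hw
  by_contra hY
  obtain ⟨f, S, E, D⟩ := exists_dec H l hne hx
  have C : Ctx ξ l f S E (mk X * mk Y * (mk X)⁻¹) X.length Y.length := by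
    refine ⟨H, D, List.length_pos_iff.2 hne, hx, List.length_pos_iff.2 hY, ?_, ?_⟩
    · rw [hw, List.length_append, List.length_append, len_pow]; omega
    · intro s h1 h2
      obtain ⟨t, rfl⟩ : ∃ t, s = X.length + t := ⟨s - X.length, by omega⟩
      have ht : t ≤ 500 * Y.length := by omega
      have hlen : (List.replicate (500 + 1) Y).flatten.length = 501 * Y.length := len_pow Y 501
      rw [hw, List.append_assoc, add_assoc, List.take_length_add_append,
        List.take_length_add_append, List.take_append_of_le_length (by rw [hlen]; omega),
        List.take_append_of_le_length (by rw [hlen]; omega), take_pow_succ, take_pow_le _ _ _ ht,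
        ← mul_mk, ← mul_mk, ← mul_mk]
      group
  exact C.false_of hseq

theorem main_len {ξ : FreeGroup α} (H : Hyp ξ) (l : List (FreeGroup α × Bool)) (hne : l ≠ [])
    (hx : ∀ p ∈ l, p.1 ≠ 1 ∧ p.1.toWord.length ≤ 192) :
    ξ.toWord.length ≤ (sprod ξ l).toWord.length + 192 := by
  have hn := H.hlen
  obtain ⟨f, S, E, D⟩ := exists_dec H l hne hx
  by_cases h1 : l.length = 1
  · obtain ⟨p, rfl⟩ := List.length_eq_one_iff.1 h1
    have hp := (hx p (by simp)).2
    have e : sg ξ p.2 = sprod ξ [p] * p.1⁻¹ := by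
      rw [sprod_cons]; simp [sprod]
    have h2 := FreeGroup.norm_mul_le (sprod ξ [p]) p.1⁻¹
    rw [← e, FreeGroup.norm_inv_eq] at h2
    have h3 := X_len ξ p.2
    unfold FreeGroup.norm at h2
    omega
  · have hpos := List.length_pos_iff.2 hne
    have hlast : l.length - 1 = (l.length - 2) + 1 := by omega
    have key : ∀ i, i + 1 < l.length → ξ.toWord.length ≤ E (i + 1) := by
      intro i hi
      have a1 := D.ES i hi
      have a2 := D.fE i (by omega)
      have a3 := D.Sf (i + 1) hi
      have a4 := D.fE (i + 1) hi
      omega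
    have := key (l.length - 2) (by omega)
    have := D.El
    rw [hlast] at this
    omega

end

end Lem5

/-- Lemma 5 of the paper: in the free group `F_k`, if `ξ` is 3-aperiodic, of length
`≥ 10000`, satisfies `C'(1/5)`, and decomposes as `ξ = α ξ⁽⁰⁾ β` with
`|α| = |β| = 400` and `{α, β}` satisfying `C'(1/3)`, and if the `xᵢ` are nontrivial
of length `≤ 192` and form a 10-aperiodic sequence, then the reduced form of
`W = ξ^{ε₁} x₁ ⋯ ξ^{ε_k} x_k` is 500-aperiodic; in particular
`|W| ≥ |ξ| − 800 > 192`. -/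
theorem stmt_17 (k : ℕ) (hk : 1 ≤ k) (ξ : FreeGroup (Fin k))
    (hap : KAperiodic 3 ξ.toWord)
    (hlen : 10000 ≤ ξ.toWord.length)
    (hsc : CPrime (1/5) {ξ.toWord})
    (hdecomp : ∃ A B C : List (Fin k × Bool), ξ.toWord = A ++ C ++ B ∧
      A.length = 400 ∧ B.length = 400 ∧ CPrime (1/3) {A, B})
    (l : List (FreeGroup (Fin k) × Bool)) (hne : l ≠ [])
    (hx : ∀ p ∈ l, p.1 ≠ 1 ∧ p.1.toWord.length ≤ 192)
    (hseq : KAperiodic 10 (l.map Prod.fst)) :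
    KAperiodic 500 (sprod ξ l).toWord ∧
      ξ.toWord.length - 800 ≤ (sprod ξ l).toWord.length ∧
      192 < (sprod ξ l).toWord.length := by
  have H : Lem5.Hyp ξ := ⟨hap, hlen, hsc⟩
  have h1 := Lem5.main_len H l hne hx
  exact ⟨Lem5.main H l hne hx hseq, by omega, by omega⟩
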